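/- For y > 0, the infinite product ∏_{n=1}^{∞} (1 − e^{−2πny}) converges to a positive real number; define η(iy) = e^{−πy/12} ∏_{n=1}^{∞} (1 − e^{−2πny}). Then for every x > 0, η(i/x) = √x · η(ix). -/

import Mathlib

open Real

/-- The Dedekind eta function on the positive imaginary axis:
`η(iy) = e^{−πy/12} ∏_{n≥1} (1 − e^{−2πny})`. -/
noncomputable def etaI (y : ℝ) : ℝ :=
  Real.exp (-π * y / 12) * ∏' n : ℕ, (1 - Real.exp (-2 * π * (n + 1) * y))

open ModularForm in
lemma norm_one_sub_eta_q_mul_I {y : ℝ} (hy : 0 < y) (n : ℕ) :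
    ‖1 - eta_q n (y * Complex.I)‖ = 1 - Real.exp (-2 * π * (n + 1) * y) := by
  have h : (1 : ℂ) - eta_q n (y * Complex.I) =
      ((1 - Real.exp (-2 * π * (n + 1) * y) : ℝ) : ℂ) := by
    rw [eta_q_eq_cexp]
    push_cast
    congr 2
    linear_combination (2 * π * (n + 1) * y : ℂ) * Complex.I_mul_I
  rw [h, Complex.norm_of_nonneg]
  have : 0 ≤ 2 * π * (n + 1) * y := by positivity
  simpa using this

lemma mul_I_mem_upperHalfPlaneSet {y : ℝ} (hy : 0 < y) :
    (y * Complex.I : ℂ) ∈ UpperHalfPlane.upperHalfPlaneSet := by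
  simpa using hy

open ModularForm in
lemma multipliable_one_sub_eta_q_mul_I {y : ℝ} (hy : 0 < y) :
    Multipliable fun n : ℕ => 1 - eta_q n (y * Complex.I) :=
  multipliableLocallyUniformlyOn_eta.multipliable (mul_I_mem_upperHalfPlaneSet hy)

open ModularForm in
lemma norm_tprod_one_sub_eta_q_mul_I {y : ℝ} (hy : 0 < y) :
    ‖∏' n : ℕ, (1 - eta_q n (y * Complex.I))‖ =
      ∏' n : ℕ, (1 - Real.exp (-2 * π * (n + 1) * y)) := by
  simp_rw [(multipliable_one_sub_eta_q_mul_I hy).norm_tprod, norm_one_sub_eta_q_mul_I hy]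

lemma norm_eta_mul_I {y : ℝ} (hy : 0 < y) : ‖ModularForm.eta (y * Complex.I)‖ = etaI y := by
  rw [ModularForm.eta, norm_mul, norm_tprod_one_sub_eta_q_mul_I hy,
    Function.Periodic.norm_qParam, etaI]
  congr 2
  simp
  ring

lemma norm_complex_sqrt (z : ℂ) : ‖Complex.sqrt z‖ = Real.sqrt ‖z‖ := by
  have h : Complex.sqrt z ^ 2 = z := Complex.cpow_ofNat_inv_pow z 2
  conv_rhs => rw [← h, norm_pow, Real.sqrt_sq (norm_nonneg _)]

/-- For `y > 0` the product defining `η(iy)` converges to a positive number, and the eta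
function satisfies the functional equation `η(i/x) = √x · η(ix)`. -/
theorem dedekind_eta_functional_equation :
    (∀ y : ℝ, 0 < y →
      Multipliable (fun n : ℕ => (1 - Real.exp (-2 * π * (n + 1) * y))) ∧
      0 < ∏' n : ℕ, (1 - Real.exp (-2 * π * (n + 1) * y))) ∧
    (∀ x : ℝ, 0 < x → etaI (1 / x) = Real.sqrt x * etaI x) := by
  refine ⟨fun y hy => ⟨?_, ?_⟩, fun x hx => ?_⟩
  · exact (multipliable_one_sub_eta_q_mul_I hy).norm.congr fun n =>
      norm_one_sub_eta_q_mul_I hy n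
  · rw [← norm_tprod_one_sub_eta_q_mul_I hy, norm_pos_iff]
    exact ModularForm.eta_tprod_ne_zero (mul_I_mem_upperHalfPlaneSet hy)
  · have h := congrArg norm
      (ModularForm.eta_comp_eq_csqrt_I_inv (mul_I_mem_upperHalfPlaneSet hx))
    have hinv : (-1 / (x * Complex.I) : ℂ) = ((1 / x : ℝ) : ℂ) * Complex.I := by
      have : (x : ℂ) ≠ 0 := by exact_mod_cast hx.ne'
      push_cast
      field_simp
      simp
    simp only [Function.comp_apply, Pi.smul_apply, Pi.mul_apply, smul_eq_mul, hinv, norm_mul,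
      norm_inv, norm_complex_sqrt, norm_eta_mul_I hx, norm_eta_mul_I (one_div_pos.mpr hx)] at h
    simpa [abs_of_pos hx] using h
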